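/- Let d ≥ 1 and A ≥ d + 2, and let S be a finite set of distinct permutations of {1,…,A} such that the profile whose individuals are exactly the members of S is d-Euclidean. Then for every (d+2)-element subset T of {1,…,A} and every linear order ℓ on T, it is not the case that all d + 2 cyclic shifts of ℓ arise as the induced order on T of some member of S. -/

import Mathlib

/-- More than `d + 1` vectors in a `d`-dimensional space satisfy a linear relation whose
coefficients are not all equal. -/
lemma exists_nonconstant_relation {E ι : Type*} [AddCommGroup E] [Module ℝ E]
    [FiniteDimensional ℝ E] [Fintype ι] (u : ι → E)
    (h : Module.finrank ℝ E + 1 < Fintype.card ι) :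
    ∃ α : ι → ℝ, ∑ p, α p • u p = 0 ∧ ∃ p q, α p ≠ α q := by
  have : Nonempty ι := Fintype.card_pos_iff.mp (by omega)
  obtain ⟨i⟩ := this
  have hker := LinearMap.ker_ne_bot_of_finrank_lt
    (f := (Fintype.linearCombination ℝ u).prod (LinearMap.proj (R := ℝ) (φ := fun _ : ι => ℝ) i))
    (by simpa using h)
  obtain ⟨α, hα, hne⟩ := (Submodule.ne_bot_iff _).mp hker
  replace hα : ∑ p, α p • u p = 0 ∧ α i = 0 := by
    simpa [LinearMap.mem_ker, Function.prod, Prod.ext_iff, Fintype.linearCombination_apply]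
      using hα
  obtain ⟨k, hk⟩ := Function.ne_iff.mp hne
  exact ⟨α, hα.1, k, i, by simpa [hα.2] using hk⟩

/-- If `e` has zero sum and is positive away from a maximizer `m` of the nonconstant
function `α`, then `∑ α p * e p` is negative. -/
lemma sum_mul_neg_of_isMax {ι : Type*} [Fintype ι] {α e : ι → ℝ} {m : ι}
    (hm : ∀ p, α p ≤ α m) (hα : ∃ p q, α p ≠ α q) (he : ∀ p, p ≠ m → 0 < e p)
    (hsum : ∑ p, e p = 0) : ∑ p, α p * e p < 0 := by
  have hshift : ∑ p, α p * e p = ∑ p, (α p - α m) * e p := by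
    simp [sub_mul, Finset.sum_sub_distrib, ← Finset.mul_sum, hsum]
  obtain ⟨k, hk⟩ : ∃ k, α k ≠ α m := by
    by_contra! hc
    obtain ⟨p, q, hpq⟩ := hα
    exact hpq ((hc p).trans (hc q).symm)
  rw [hshift]
  refine Finset.sum_neg' (fun p _ => ?_) ⟨k, Finset.mem_univ k, ?_⟩
  · rcases eq_or_ne p m with rfl | hp
    · simp
    · exact mul_nonpos_of_nonpos_of_nonneg (sub_nonpos.mpr (hm p)) (he p hp).le
  · exact mul_neg_of_neg_of_pos (sub_neg.mpr ((hm k).lt_of_ne hk))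
      (he k fun h => hk (congrArg α h))

/-- In a Euclidean space of dimension `d`, there are no `d + 2` points for which every cyclic
shift of their enumeration is the order by distance from some ideal point. -/
lemma not_all_cyclic_shifts_by_distance {E : Type*} [NormedAddCommGroup E]
    [InnerProductSpace ℝ E] [FiniteDimensional ℝ E] {d : ℕ} (hd : Module.finrank ℝ E = d)
    (y w : Fin (d + 2) → E)
    (h : ∀ j p q : Fin (d + 2), p < q → ‖y (j + p) - w j‖ < ‖y (j + q) - w j‖) : False := by
  obtain ⟨α, hrel, hα⟩ := exists_nonconstant_relation (fun p => y (p + 1) - y p)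
    (by simp [hd])
  let e (j p : Fin (d + 2)) : ℝ := ‖y (p + 1) - w j‖ ^ 2 - ‖y p - w j‖ ^ 2
  have hsum (j) : ∑ p, e j p = 0 := by
    simp only [e, Finset.sum_sub_distrib]
    exact sub_eq_zero.mpr (Equiv.sum_comp (Equiv.addRight 1) fun p => ‖y p - w j‖ ^ 2)
  have hpos (m p : Fin (d + 2)) (hp : p ≠ m) : 0 < e (m + 1) p := by
    have hlt : p - (m + 1) < p - (m + 1) + 1 := by
      rw [Fin.lt_add_one_iff, Fin.lt_last_iff_ne_last]
      intro hlast
      have h0 : p - (m + 1) + 1 = 0 := by rw [hlast, Fin.last_add_one]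
      rw [← sub_sub, sub_add_cancel] at h0
      exact hp (sub_eq_zero.mp h0)
    have hdist := h (m + 1) _ _ hlt
    rw [← add_assoc, add_sub_cancel] at hdist
    exact sub_pos.mpr (pow_lt_pow_left₀ hdist (norm_nonneg _) two_ne_zero)
  have hconst (j) : ∑ p, α p * e j p = ∑ p, α p * (‖y (p + 1)‖ ^ 2 - ‖y p‖ ^ 2) := by
    have hinner : ∑ p, α p * inner ℝ (y (p + 1) - y p) (w j) = 0 := by
      simpa [sum_inner, real_inner_smul_left] using congrArg (inner ℝ · (w j)) hrel
    rw [← sub_eq_zero, ← Finset.sum_sub_distrib, ← mul_zero (-2 : ℝ), ← hinner, Finset.mul_sum]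
    refine Finset.sum_congr rfl fun p _ => ?_
    simp only [e, norm_sub_sq_real, inner_sub_left]
    ring
  obtain ⟨M, hM⟩ := Finite.exists_max α
  obtain ⟨m, hm⟩ := Finite.exists_min α
  have hneg := sum_mul_neg_of_isMax hM hα (hpos M) (hsum (M + 1))
  have hneg' := sum_mul_neg_of_isMax (α := fun p => -α p) (fun p => neg_le_neg (hm p))
    (by simpa using hα) (hpos m) (hsum (m + 1))
  simp only [neg_mul, Finset.sum_neg_distrib] at hneg'
  rw [hconst] at hneg hneg'
  linarith

/-- Let `d ≥ 1`, `A ≥ d + 2`, and let `S` be a finite set of permutations of `Fin A`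
(preferences: individual `σ` prefers `a` to `b` iff `σ a < σ b`) such that the profile
whose individuals are exactly the members of `S` is `d`-Euclidean.  Then for every
`(d+2)`-element subset `T` of the alternatives and every linear order on `T`
(represented by an injective enumeration `ℓ : Fin (d+2) → Fin A` of `T`, ranking
`ℓ 0 > ℓ 1 > …`), it is not the case that all `d + 2` cyclic shifts of the order
arise as the induced order on `T` of some member of `S`. -/
theorem euclidean_set_misses_some_cyclic_shift
    (A d : ℕ) (hd : 1 ≤ d) (hA : d + 2 ≤ A)
    (S : Finset (Equiv.Perm (Fin A)))
    (hS : ∃ (x : Fin A → EuclideanSpace ℝ (Fin d)) (w : S → EuclideanSpace ℝ (Fin d)),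
      ∀ (σ : S) (a b : Fin A),
        (σ : Equiv.Perm (Fin A)) a < (σ : Equiv.Perm (Fin A)) b ↔ ‖x a - w σ‖ < ‖x b - w σ‖) :
    ∀ T : Finset (Fin A), T.card = d + 2 →
      ∀ ℓ : Fin (d + 2) → Fin A, Function.Injective ℓ → (∀ p, ℓ p ∈ T) →
        ¬ (∀ j : Fin (d + 2), ∃ σ ∈ S, ∀ p q : Fin (d + 2), p < q →
            σ (ℓ (j + p)) < σ (ℓ (j + q))) := by
  obtain ⟨x, w, hxw⟩ := hS
  intro T _ ℓ _ _ h
  choose σ hσ hlt using h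
  exact not_all_cyclic_shifts_by_distance finrank_euclideanSpace_fin (fun p => x (ℓ p))
    (fun j => w ⟨σ j, hσ j⟩) fun j p q hpq => (hxw ⟨σ j, hσ j⟩ _ _).mp (hlt j p q hpq)
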